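/- arXiv:2411.10439 — 2 statements merged into one kernel-verified Lean document; each statement's English description precedes it below -/
import Mathlib

section
/- For every φ ∈ Cvx(ℝⁿ) and every y ∈ ℝⁿ, lim_{p→∞} φ^{*,p}(y) = φ^*(y) (as a limit in ℝ ∪ {+∞}), where φ^* is the classical Legendre transform. -/
open MeasureTheory Real Filter
open scoped ENNReal RealInnerProductSpace Classical

noncomputable section

abbrev Euc (n : ℕ) : Type := EuclideanSpace ℝ (Fin n)

/-- `e^t` as an extended nonnegative real, for `t : EReal` (`e^{-∞}=0`, `e^{+∞}=∞`). -/
def erealExp (t : EReal) : ℝ≥0∞ :=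
  if t = ⊥ then 0 else if t = ⊤ then ⊤ else ENNReal.ofReal (Real.exp t.toReal)

/-- The volume `V(f) = ∫ e^{-f}` of `f : ℝⁿ → ℝ ∪ {+∞}`, as an extended nonnegative real. -/
def VolE {n : ℕ} (f : Euc n → EReal) : ℝ≥0∞ := ∫⁻ x, erealExp (-(f x))

/-- The volume `V(f) = ∫ e^{-f}` as a real number. -/
def Vol {n : ℕ} (f : Euc n → EReal) : ℝ := (VolE f).toReal

/-- `∫ e^{p⟨x,y⟩ - (p+1) f(x)} dx`. -/
def LpIntE {n : ℕ} (p : ℝ) (f : Euc n → EReal) (y : Euc n) : ℝ≥0∞ :=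
  ∫⁻ x, erealExp (((p * ⟪x, y⟫ : ℝ) : EReal) - ((p + 1 : ℝ) : EReal) * f x)

/-- The `L^p`-Legendre transform
`f^{*,p}(y) = (1/p) log ( ∫ e^{p⟨x,y⟩ - (p+1) f(x)} dx / V(f) )`,
with value `+∞` when the integral diverges. -/
def LpStar {n : ℕ} (p : ℝ) (f : Euc n → EReal) (y : Euc n) : EReal :=
  if LpIntE p f y = ⊤ then ⊤
  else (((1 / p) * Real.log ((LpIntE p f y).toReal / Vol f) : ℝ) : EReal)

/-- The `L^p`-Mahler integral `M_p(f) = V(f) · V(f^{*,p})`, as an extended nonnegative real. -/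
def MpE {n : ℕ} (p : ℝ) (f : Euc n → EReal) : ℝ≥0∞ := VolE f * VolE (LpStar p f)

/-- The translate `(T_a f)(x) = f(x + a)`. -/
def Transl {n : ℕ} (a : Euc n) (f : Euc n → EReal) : Euc n → EReal := fun x => f (x + a)

/-- Convexity of an `ℝ ∪ {+∞}`-valued function. -/
def ConvexE {n : ℕ} (φ : Euc n → EReal) : Prop :=
  ∀ x y : Euc n, ∀ l : ℝ, 0 ≤ l → l ≤ 1 →
    φ ((1 - l) • x + l • y) ≤ ((1 - l : ℝ) : EReal) * φ x + ((l : ℝ) : EReal) * φ y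

/-- The class `Cvx(ℝⁿ)`: convex, lower semicontinuous functions `ℝⁿ → ℝ ∪ {+∞}`,
not identically `+∞`, with `0 < V(φ) < ∞`. -/
structure InCvx {n : ℕ} (φ : Euc n → EReal) : Prop where
  noBot : ∀ x, φ x ≠ ⊥
  convex : ConvexE φ
  lsc : LowerSemicontinuous φ
  proper : ∃ x, φ x ≠ ⊤
  volPos : 0 < VolE φ
  volFin : VolE φ < ⊤

/-- The barycenter `b(g) = ∫ x e^{-g(x)} dx / V(g)`. -/
def bary {n : ℕ} (g : Euc n → EReal) : Euc n :=
  (Vol g)⁻¹ • ∫ x, (erealExp (-(g x))).toReal • x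

/-- The classical Legendre transform `f^*(y) = sup_x (⟨x,y⟩ - f(x))`. -/
def Lstar {n : ℕ} (f : Euc n → EReal) (y : Euc n) : EReal :=
  ⨆ x : Euc n, (((⟪x, y⟫ : ℝ) : EReal) - f x)




lemma erealExp_coe (r : ℝ) : erealExp (r : EReal) = ENNReal.ofReal (Real.exp r) := by
  simp [erealExp]

lemma erealExp_bot : erealExp ⊥ = 0 := by
  simp [erealExp]

lemma integrand_top (p a : ℝ) (hp : 0 < p) :
    ((p * a : ℝ) : EReal) - ((p + 1 : ℝ) : EReal) * ⊤ = ⊥ := by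
  rw [EReal.coe_mul_top_of_pos (by linarith)]
  exact EReal.sub_top _

lemma integrand_coe (p a r : ℝ) :
    erealExp (((p * a : ℝ) : EReal) - ((p + 1 : ℝ) : EReal) * (r : EReal))
      = ENNReal.ofReal (Real.exp (p * a - (p + 1) * r)) := by
  rw [← EReal.coe_mul, ← EReal.coe_sub, erealExp_coe]

lemma integrand_le {n : ℕ} {φ : Euc n → EReal} (hφ : InCvx φ) (y : Euc n) (L p : ℝ) (hp : 0 < p)
    (hL : Lstar φ y ≤ L) (x : Euc n) :
    erealExp (((p * ⟪x, y⟫ : ℝ) : EReal) - ((p + 1 : ℝ) : EReal) * φ x)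
      ≤ ENNReal.ofReal (Real.exp (p * L)) * erealExp (-(φ x)) := by
  have h1 : ((⟪x, y⟫ : ℝ) : EReal) - φ x ≤ L :=
    le_trans (le_iSup (fun x : Euc n => (((⟪x, y⟫ : ℝ) : EReal) - φ x)) x) hL
  have hb := hφ.noBot x
  generalize φ x = t at *
  induction t with
  | bot => exact absurd rfl hb
  | top => rw [integrand_top p _ hp, erealExp_bot]; exact zero_le
  | coe r =>
    rw [integrand_coe, ← EReal.coe_neg, erealExp_coe, ← ENNReal.ofReal_mul (Real.exp_pos _).le,
      ← Real.exp_add]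
    rw [← EReal.coe_sub, EReal.coe_le_coe_iff] at h1
    apply ENNReal.ofReal_le_ofReal
    apply Real.exp_le_exp.2
    nlinarith

lemma exists_good_set {n : ℕ} {φ : Euc n → EReal} (hφ : InCvx φ) :
    ∃ N : ℕ, volume ({x | φ x ≤ ((N : ℝ) : EReal)} ∩ Metric.closedBall 0 (N : ℝ)) ≠ 0 := by
  by_contra! h
  have h1 : volume (⋃ N : ℕ, ({x | φ x ≤ ((N : ℝ) : EReal)} ∩ Metric.closedBall 0 (N : ℝ))) = 0 :=
    measure_iUnion_null h
  have h2 : ∀ᵐ x, erealExp (-(φ x)) = 0 := by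
    rw [ae_iff]
    refine measure_mono_null ?_ h1
    intro x hx
    simp only [Set.mem_ofPred_eq] at hx
    have hb := hφ.noBot x
    have ht : φ x ≠ ⊤ := by
      intro h; apply hx; rw [h]; exact erealExp_bot
    obtain ⟨N, hN⟩ := exists_nat_ge (max (φ x).toReal ‖x‖)
    refine Set.mem_iUnion.2 ⟨N, ?_, ?_⟩
    · simp only [Set.mem_ofPred_eq]
      rw [← EReal.coe_toReal ht hb, EReal.coe_le_coe_iff]
      exact (le_max_left _ _).trans hN
    · rw [mem_closedBall_zero_iff]
      exact (le_max_right _ _).trans hN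
  have h3 : VolE φ = 0 := by
    unfold VolE
    rw [lintegral_congr_ae h2]; simp
  exact hφ.volPos.ne' h3

lemma exists_lower_set {n : ℕ} {φ : Euc n → EReal} (hφ : InCvx φ) (y : Euc n) (c : ℝ)
    (hc : (c : EReal) < Lstar φ y) :
    ∃ (S : Set (Euc n)) (K : ℝ), MeasurableSet S ∧ volume S ≠ 0 ∧ volume S ≠ ⊤ ∧
      ∀ x ∈ S, ∃ r : ℝ, φ x = r ∧ r ≤ K ∧ c ≤ ⟪x, y⟫ - r := by
  obtain ⟨x₀, hx₀⟩ := lt_iSup_iff.1 hc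
  obtain ⟨N, hN⟩ := exists_good_set hφ
  have hb := hφ.noBot x₀
  have ht : φ x₀ ≠ ⊤ := by
    intro h; rw [h, EReal.sub_top] at hx₀; exact not_lt_bot hx₀
  obtain ⟨r₀, hr₀⟩ : ∃ r : ℝ, φ x₀ = r := ⟨_, (EReal.coe_toReal ht hb).symm⟩
  rw [hr₀, ← EReal.coe_sub, EReal.coe_lt_coe_iff] at hx₀
  set A := {x | φ x ≤ ((N : ℝ) : EReal)} ∩ Metric.closedBall (0 : Euc n) (N : ℝ) with hA
  have hAm : MeasurableSet A :=
    (hφ.lsc.isClosed_preimage _).measurableSet.inter Metric.isClosed_closedBall.measurableSet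
  have hlim : Tendsto (fun l : ℝ => (1 - l) * (⟪x₀, y⟫ - r₀) + l * (-(N * ‖y‖) - N))
      (nhdsWithin 0 (Set.Ioi 0)) (nhds (⟪x₀, y⟫ - r₀)) := by
    have : Continuous (fun l : ℝ => (1 - l) * (⟪x₀, y⟫ - r₀) + l * (-(N * ‖y‖) - N)) := by
      fun_prop
    have := this.tendsto 0
    simp only [sub_zero, one_mul, zero_mul, add_zero] at this
    exact this.mono_left nhdsWithin_le_nhds
  obtain ⟨l, hl1, hl2, hl3⟩ := ((hlim.eventually (lt_mem_nhds hx₀)).and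
    (Ioo_mem_nhdsGT (zero_lt_one (α := ℝ)))).exists
  refine ⟨(fun x => (1 - l) • x₀ + x) '' ((fun x => l • x) '' A), (1 - l) * r₀ + l * N, ?_, ?_, ?_, ?_⟩
  · rw [Set.image_smul]
    exact (MeasurableEquiv.addLeft ((1 - l) • x₀)).measurableSet_image.2
      (hAm.const_smul_of_ne_zero hl2.ne')
  · rw [Set.image_smul, Set.image_add_left, measure_preimage_add, Measure.addHaar_smul]
    refine mul_ne_zero ?_ hN
    rw [Ne, ENNReal.ofReal_eq_zero, not_le]
    exact abs_pos.2 (pow_ne_zero _ hl2.ne')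
  · rw [Set.image_smul, Set.image_add_left, measure_preimage_add, Measure.addHaar_smul]
    refine ENNReal.mul_ne_top ENNReal.ofReal_ne_top ?_
    exact ne_top_of_le_ne_top Metric.isBounded_closedBall.measure_lt_top.ne
      (measure_mono Set.inter_subset_right)
  · rintro _ ⟨_, ⟨a, ⟨ha1, ha2⟩, rfl⟩, rfl⟩
    have hconv := hφ.convex x₀ a l hl2.le hl3.le
    have hba := hφ.noBot a
    have hta : φ a ≠ ⊤ := by
      intro h
      simp only [Set.mem_ofPred_eq] at ha1
      rw [h] at ha1
      exact EReal.coe_ne_top _ (top_le_iff.1 ha1)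
    obtain ⟨s, hs⟩ : ∃ r : ℝ, φ a = r := ⟨_, (EReal.coe_toReal hta hba).symm⟩
    simp only [Set.mem_ofPred_eq] at ha1
    rw [hs, EReal.coe_le_coe_iff] at ha1
    rw [mem_closedBall_zero_iff] at ha2
    rw [hr₀, hs, ← EReal.coe_mul, ← EReal.coe_mul, ← EReal.coe_add] at hconv
    have htz := (hconv.trans_lt (EReal.coe_lt_top _)).ne
    obtain ⟨r, hr⟩ : ∃ r : ℝ, φ ((1 - l) • x₀ + l • a) = r :=
      ⟨_, (EReal.coe_toReal htz (hφ.noBot _)).symm⟩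
    rw [hr, EReal.coe_le_coe_iff] at hconv
    have hls : l * s ≤ l * N := mul_le_mul_of_nonneg_left ha1 hl2.le
    refine ⟨r, hr, by linarith, ?_⟩
    have hin : -(N * ‖y‖) ≤ ⟪a, y⟫ := by
      have h1 := neg_le_of_abs_le (abs_real_inner_le_norm a y)
      have h2 := mul_le_mul_of_nonneg_right ha2 (norm_nonneg y)
      linarith
    have hin2 := mul_le_mul_of_nonneg_left hin hl2.le
    rw [inner_add_left, real_inner_smul_left, real_inner_smul_left]
    linarith

lemma lower_int {n : ℕ} {φ : Euc n → EReal} (hφ : InCvx φ) (y : Euc n) (c : ℝ)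
    (hc : (c : EReal) < Lstar φ y) :
    ∃ m : ℝ, 0 < m ∧ ∀ p : ℝ, 0 < p → ENNReal.ofReal (Real.exp (p * c) * m) ≤ LpIntE p φ y := by
  obtain ⟨S, K, hS, h0, ht, h⟩ := exists_lower_set hφ y c hc
  refine ⟨Real.exp (-K) * (volume S).toReal,
    mul_pos (Real.exp_pos _) (ENNReal.toReal_pos h0 ht), fun p hp => ?_⟩
  rw [← mul_assoc, ← Real.exp_add, ENNReal.ofReal_mul (Real.exp_pos _).le, ENNReal.ofReal_toReal ht,
    ← setLIntegral_const]
  refine le_trans (setLIntegral_mono' hS ?_) (setLIntegral_le_lintegral S _)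
  intro x hx
  obtain ⟨r, hr, hrK, hcr⟩ := h x hx
  rw [hr, integrand_coe]
  apply ENNReal.ofReal_le_ofReal
  apply Real.exp_le_exp.2
  nlinarith

lemma Vol_pos {n : ℕ} {φ : Euc n → EReal} (hφ : InCvx φ) : 0 < Vol φ :=
  ENNReal.toReal_pos hφ.volPos.ne' hφ.volFin.ne

lemma LpStar_le {n : ℕ} {φ : Euc n → EReal} (hφ : InCvx φ) (y : Euc n) (p : ℝ) (hp : 0 < p) :
    LpStar p φ y ≤ Lstar φ y := by
  have hV := Vol_pos hφ
  obtain ⟨x₀, hx₀⟩ := hφ.proper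
  have hbot : Lstar φ y ≠ ⊥ := by
    intro h
    have h1 : ((⟪x₀, y⟫ : ℝ) : EReal) - φ x₀ ≤ ⊥ :=
      h ▸ le_iSup (fun x : Euc n => (((⟪x, y⟫ : ℝ) : EReal) - φ x)) x₀
    rw [← EReal.coe_toReal hx₀ (hφ.noBot x₀), ← EReal.coe_sub] at h1
    exact EReal.coe_ne_bot _ (le_bot_iff.1 h1)
  by_cases htop : Lstar φ y = ⊤
  · rw [htop]; exact le_top
  obtain ⟨L, hL⟩ : ∃ L : ℝ, Lstar φ y = L := ⟨_, (EReal.coe_toReal htop hbot).symm⟩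
  obtain ⟨m, hm, hlow⟩ := lower_int hφ y (L - 1) (by
    rw [hL, EReal.coe_lt_coe_iff]; linarith)
  have hI : LpIntE p φ y ≤ ENNReal.ofReal (Real.exp (p * L)) * VolE φ := by
    unfold LpIntE VolE
    rw [← lintegral_const_mul' _ _ ENNReal.ofReal_ne_top]
    exact lintegral_mono (integrand_le hφ y L p hp hL.le)
  have hfin : ENNReal.ofReal (Real.exp (p * L)) * VolE φ ≠ ⊤ :=
    ENNReal.mul_ne_top ENNReal.ofReal_ne_top hφ.volFin.ne
  have hIt : LpIntE p φ y ≠ ⊤ := ne_top_of_le_ne_top hfin hI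
  have hIpos : 0 < (LpIntE p φ y).toReal := by
    have := (ENNReal.ofReal_le_iff_le_toReal hIt).1 (hlow p hp)
    exact lt_of_lt_of_le (mul_pos (Real.exp_pos _) hm) this
  have hIr : (LpIntE p φ y).toReal ≤ Real.exp (p * L) * Vol φ := by
    have := ENNReal.toReal_mono hfin hI
    rwa [ENNReal.toReal_mul, ENNReal.toReal_ofReal (Real.exp_pos _).le] at this
  rw [LpStar, if_neg hIt, hL, EReal.coe_le_coe_iff]
  have : Real.log ((LpIntE p φ y).toReal / Vol φ) ≤ p * L := by
    rw [Real.log_le_iff_le_exp (div_pos hIpos hV), div_le_iff₀ hV]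
    exact hIr
  rw [one_div, inv_mul_le_iff₀ hp]
  exact this

lemma le_LpStar {n : ℕ} {φ : Euc n → EReal} (hφ : InCvx φ) (y : Euc n) (c : ℝ)
    (hc : (c : EReal) < Lstar φ y) :
    ∃ C : ℝ, ∀ p : ℝ, 0 < p → ((c + p⁻¹ * C : ℝ) : EReal) ≤ LpStar p φ y := by
  have hV := Vol_pos hφ
  obtain ⟨m, hm, hlow⟩ := lower_int hφ y c hc
  refine ⟨Real.log (m / Vol φ), fun p hp => ?_⟩
  by_cases hIt : LpIntE p φ y = ⊤
  · rw [LpStar, if_pos hIt]; exact le_top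
  have h := (ENNReal.ofReal_le_iff_le_toReal hIt).1 (hlow p hp)
  rw [LpStar, if_neg hIt, EReal.coe_le_coe_iff]
  have h1 : p * c + Real.log (m / Vol φ) ≤ Real.log ((LpIntE p φ y).toReal / Vol φ) := by
    have h2 : Real.exp (p * c) * (m / Vol φ) ≤ (LpIntE p φ y).toReal / Vol φ := by
      rw [← mul_div_assoc]
      exact div_le_div_of_nonneg_right h hV.le
    have h3 := Real.log_le_log (mul_pos (Real.exp_pos _) (div_pos hm hV)) h2
    rwa [Real.log_mul (Real.exp_pos _).ne' (div_pos hm hV).ne', Real.log_exp] at h3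
  have h4 := mul_le_mul_of_nonneg_left h1 (inv_pos.2 hp).le
  rw [mul_add, inv_mul_cancel_left₀ hp.ne'] at h4
  rwa [one_div]

/-- convergence of the `L^p`-Legendre transform to the classical one.
For `φ ∈ Cvx(ℝⁿ)` and `y ∈ ℝⁿ`, `lim_{p→∞} φ^{*,p}(y) = φ^*(y)` in `ℝ ∪ {+∞}`. -/
theorem lp_legendre_tendsto (n : ℕ) (φ : Euc n → EReal) (hφ : InCvx φ) (y : Euc n) :
    Filter.Tendsto (fun p : ℝ => LpStar p φ y) Filter.atTop (nhds (Lstar φ y)) := by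
  refine tendsto_order.2 ⟨fun a ha => ?_, fun a ha => ?_⟩
  · obtain ⟨c, hac, hcL⟩ := EReal.lt_iff_exists_real_btwn.1 ha
    obtain ⟨c', hac', hcc'⟩ := EReal.lt_iff_exists_real_btwn.1 hac
    rw [EReal.coe_lt_coe_iff] at hcc'
    obtain ⟨C, hC⟩ := le_LpStar hφ y c hcL
    have hlim : Tendsto (fun p : ℝ => c + p⁻¹ * C) atTop (nhds c) := by
      simpa using (tendsto_inv_atTop_zero.mul_const C).const_add c
    filter_upwards [hlim.eventually (lt_mem_nhds hcc'), eventually_gt_atTop 0] with p hp1 hp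
    exact hac'.trans ((EReal.coe_lt_coe_iff.2 hp1).trans_le (hC p hp))
  · filter_upwards [eventually_gt_atTop 0] with p hp
    exact (LpStar_le hφ y p hp).trans_lt ha

end
end

section
/- Let p, q ∈ (0,∞) and λ ∈ (0,1). For every measurable function f : ℝⁿ → ℝ ∪ {+∞} with 0 < V(f) < ∞ and every y ∈ ℝⁿ, one has f^{*,(1−λ)p+λq}(y) ≤ ((1−λ)p/((1−λ)p+λq))·f^{*,p}(y) + (λq/((1−λ)p+λq))·f^{*,q}(y). -/
open MeasureTheory Real Filter
open scoped ENNReal RealInnerProductSpace Classical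

noncomputable section

lemma aux_meas : Measurable erealExp := by
  unfold erealExp
  refine Measurable.ite (measurableSet_singleton ⊥) measurable_const ?_
  refine Measurable.ite (measurableSet_singleton ⊤) measurable_const ?_
  fun_prop

lemma aux_coe (t : ℝ) : erealExp (t : EReal) = ENNReal.ofReal (Real.exp t) := by
  simp [erealExp]

lemma aux_integrand (p a : ℝ) (hp : 0 < p) (u : EReal) (hu : u ≠ ⊥) :
    erealExp (((p * a : ℝ) : EReal) - ((p + 1 : ℝ) : EReal) * u) =
      ENNReal.ofReal (Real.exp (p * a)) * erealExp (-u) ^ (p + 1) := by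
  have hp1 : 0 < p + 1 := by linarith
  induction u with
  | bot => exact absurd rfl hu
  | top =>
    rw [EReal.coe_mul_top_of_pos hp1]
    simp [erealExp, hp1]
  | coe t =>
    rw [← EReal.coe_mul, ← EReal.coe_sub, ← EReal.coe_neg, aux_coe, aux_coe,
      ENNReal.ofReal_rpow_of_pos (Real.exp_pos _), ← ENNReal.ofReal_mul (Real.exp_pos _).le,
      ← Real.exp_mul, ← Real.exp_add]
    congr 2
    ring

lemma aux_eq {n : ℕ} (p : ℝ) (hp : 0 < p) (f : Euc n → EReal) (hreal : ∀ x, f x ≠ ⊥)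
    (y : Euc n) : LpIntE p f y =
      ∫⁻ x, ENNReal.ofReal (Real.exp (p * ⟪x, y⟫)) * erealExp (-(f x)) ^ (p + 1) := by
  unfold LpIntE
  exact lintegral_congr fun x => aux_integrand p _ hp _ (hreal x)

lemma aux_gm {n : ℕ} (p : ℝ) (f : Euc n → EReal) (hmeas : Measurable f) (y : Euc n) :
    Measurable fun x : Euc n =>
      ENNReal.ofReal (Real.exp (p * ⟪x, y⟫)) * erealExp (-(f x)) ^ (p + 1) := by
  have h1 : Measurable fun x => erealExp (-(f x)) := aux_meas.comp hmeas.neg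
  have h2 : Measurable fun x : Euc n => (⟪x, y⟫ : ℝ) :=
    (continuous_id.inner continuous_const).measurable
  fun_prop

lemma aux_pos {n : ℕ} (p : ℝ) (hp : 0 < p) (f : Euc n → EReal) (hreal : ∀ x, f x ≠ ⊥)
    (hmeas : Measurable f) (hV0 : 0 < VolE f) (y : Euc n) : LpIntE p f y ≠ 0 := by
  intro h
  have hp1 : 0 < p + 1 := by linarith
  rw [aux_eq p hp f hreal, lintegral_eq_zero_iff (aux_gm p f hmeas y)] at h
  apply hV0.ne'
  unfold VolE
  have hm : Measurable fun x => erealExp (-(f x)) := aux_meas.comp hmeas.neg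
  rw [lintegral_eq_zero_iff hm]
  filter_upwards [h] with x hx
  have h0 : ENNReal.ofReal (Real.exp (p * ⟪x, y⟫)) ≠ 0 := by simp [Real.exp_pos]
  simp only [Pi.zero_apply, mul_eq_zero, h0, false_or] at hx ⊢
  rcases ENNReal.rpow_eq_zero_iff.1 hx with h | h
  · exact h.1
  · linarith [h.2]

lemma aux_holder {n : ℕ} (p q : ℝ) (hp : 0 < p) (hq : 0 < q)
    (l : ℝ) (hl0 : 0 < l) (hl1 : l < 1)
    (f : Euc n → EReal) (hreal : ∀ x, f x ≠ ⊥) (hmeas : Measurable f) (y : Euc n) :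
    LpIntE ((1 - l) * p + l * q) f y ≤ LpIntE p f y ^ (1 - l) * LpIntE q f y ^ l := by
  have h1l : 0 < 1 - l := by linarith
  have hr : 0 < (1 - l) * p + l * q := by positivity
  rw [aux_eq _ hr f hreal, aux_eq _ hp f hreal, aux_eq _ hq f hreal]
  refine le_trans (le_of_eq ?_) (ENNReal.lintegral_mul_norm_pow_le
    (aux_gm p f hmeas y).aemeasurable (aux_gm q f hmeas y).aemeasurable h1l.le hl0.le (by ring))
  refine lintegral_congr fun x => ?_
  rw [ENNReal.mul_rpow_of_nonneg _ _ h1l.le, ENNReal.mul_rpow_of_nonneg _ _ hl0.le,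
    ← ENNReal.rpow_mul, ← ENNReal.rpow_mul, mul_mul_mul_comm,
    ← ENNReal.rpow_add_of_nonneg _ _ (by positivity) (by positivity),
    ENNReal.ofReal_rpow_of_pos (Real.exp_pos _), ENNReal.ofReal_rpow_of_pos (Real.exp_pos _),
    ← ENNReal.ofReal_mul (by positivity), ← Real.exp_mul, ← Real.exp_mul, ← Real.exp_add]
  have e1 : p * ⟪x, y⟫ * (1 - l) + q * ⟪x, y⟫ * l = ((1 - l) * p + l * q) * ⟪x, y⟫ := by ring
  have e2 : (p + 1) * (1 - l) + (q + 1) * l = (1 - l) * p + l * q + 1 := by ring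
  rw [e1, e2]

lemma aux_ne_bot {n : ℕ} (p : ℝ) (f : Euc n → EReal) (y : Euc n) : LpStar p f y ≠ ⊥ := by
  unfold LpStar
  split_ifs <;> simp [-EReal.coe_mul]

lemma aux_coef {n : ℕ} (c p : ℝ) (hc : 0 < c) (f : Euc n → EReal) (y : Euc n) :
    (c : EReal) * LpStar p f y ≠ ⊥ := by
  unfold LpStar
  split_ifs
  · rw [EReal.coe_mul_top_of_pos hc]; simp
  · rw [← EReal.coe_mul]; exact EReal.coe_ne_bot _

/-- convexity of the transform in the index `p`.
For `p, q ∈ (0,∞)`, `λ ∈ (0,1)`, measurable `f` with `0 < V(f) < ∞`, and `y ∈ ℝⁿ`,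
`f^{*,(1-λ)p+λq}(y) ≤ ((1-λ)p/((1-λ)p+λq)) f^{*,p}(y) + (λq/((1-λ)p+λq)) f^{*,q}(y)`. -/
theorem lp_legendre_index_convex (n : ℕ) (p q : ℝ) (hp : 0 < p) (hq : 0 < q)
    (l : ℝ) (hl0 : 0 < l) (hl1 : l < 1)
    (f : Euc n → EReal) (hreal : ∀ x, f x ≠ ⊥) (hmeas : Measurable f)
    (hV0 : 0 < VolE f) (hV1 : VolE f < ⊤) (y : Euc n) :
    LpStar ((1 - l) * p + l * q) f y ≤
      (((1 - l) * p / ((1 - l) * p + l * q) : ℝ) : EReal) * LpStar p f y +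
      ((l * q / ((1 - l) * p + l * q) : ℝ) : EReal) * LpStar q f y := by
  have h1l : 0 < 1 - l := by linarith
  have hr : 0 < (1 - l) * p + l * q := by positivity
  have hc1 : 0 < (1 - l) * p / ((1 - l) * p + l * q) := by positivity
  have hc2 : 0 < l * q / ((1 - l) * p + l * q) := by positivity
  by_cases hP : LpIntE p f y = ⊤
  · have h : LpStar p f y = ⊤ := by simp [LpStar, hP]
    rw [h, EReal.coe_mul_top_of_pos hc1, EReal.top_add_of_ne_bot (aux_coef _ q hc2 f y)]
    exact le_top
  by_cases hQ : LpIntE q f y = ⊤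
  · have h : LpStar q f y = ⊤ := by simp [LpStar, hQ]
    rw [h, EReal.coe_mul_top_of_pos hc2, EReal.add_top_of_ne_bot (aux_coef _ p hc1 f y)]
    exact le_top
  have hH := aux_holder p q hp hq l hl0 hl1 f hreal hmeas y
  have hfin : LpIntE p f y ^ (1 - l) * LpIntE q f y ^ l ≠ ⊤ :=
    ENNReal.mul_ne_top (ENNReal.rpow_ne_top_of_nonneg h1l.le hP)
      (ENNReal.rpow_ne_top_of_nonneg hl0.le hQ)
  have hR : LpIntE ((1 - l) * p + l * q) f y ≠ ⊤ := ne_top_of_le_ne_top hfin hH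
  have hH' := ENNReal.toReal_mono hfin hH
  rw [ENNReal.toReal_mul, ← ENNReal.toReal_rpow, ← ENNReal.toReal_rpow] at hH'
  have pP := ENNReal.toReal_pos (aux_pos p hp f hreal hmeas hV0 y) hP
  have pQ := ENNReal.toReal_pos (aux_pos q hq f hreal hmeas hV0 y) hQ
  have pR := ENNReal.toReal_pos (aux_pos _ hr f hreal hmeas hV0 y) hR
  have pV : 0 < Vol f := ENNReal.toReal_pos hV0.ne' hV1.ne
  have hlog := Real.log_le_log pR hH'
  rw [Real.log_mul (by positivity) (by positivity), Real.log_rpow pP, Real.log_rpow pQ] at hlog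
  unfold LpStar
  rw [if_neg hP, if_neg hQ, if_neg hR, ← EReal.coe_mul, ← EReal.coe_mul, ← EReal.coe_add,
    EReal.coe_le_coe_iff, Real.log_div pP.ne' pV.ne', Real.log_div pQ.ne' pV.ne',
    Real.log_div pR.ne' pV.ne']
  generalize Real.log (LpIntE p f y).toReal = A at *
  generalize Real.log (LpIntE q f y).toReal = B at *
  generalize Real.log (LpIntE ((1 - l) * p + l * q) f y).toReal = C at *
  generalize Real.log (Vol f) = v at *
  have e : (1 - l) * p / ((1 - l) * p + l * q) * (1 / p * (A - v)) +
      l * q / ((1 - l) * p + l * q) * (1 / q * (B - v)) =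
      1 / ((1 - l) * p + l * q) * ((1 - l) * A + l * B - v) := by
    field_simp
    ring
  rw [e]
  apply mul_le_mul_of_nonneg_left _ (by positivity)
  linarith

end
end
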